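/- arXiv:2009.10754 — 2 statements merged into one kernel-verified Lean document; each statement's English description precedes it below -/
import Mathlib

section
/- For every odd integer ℓ > 0 and every n ≥ 1, there exists a function P : {-1,1}^n → ℝ such that: (i) |P̂(S) − L̂(S)| ≤ 8ℓ/2^ℓ for every S ⊆ [n], where L(x) = Σ_{j=1}^n x_j; and (ii) E[|P(X)|] ≤ 8ℓ, where X is uniform on {-1,1}^n. -/
open Finset Real

noncomputable section

/-- The discrete cube `{-1,1}^n` as a finite set of points of `ℝ^n`. -/
def cube (n : ℕ) : Finset (Fin n → ℝ) :=
  Fintype.piFinset fun _ => ({-1, 1} : Finset ℝ)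

/-- Expectation of `g(X)` for `X` uniform on the discrete cube `{-1,1}^n`. -/
def cubeAvg (n : ℕ) (g : (Fin n → ℝ) → ℝ) : ℝ :=
  (∑ x ∈ cube n, g x) / (2 : ℝ) ^ n

/-- Fourier coefficient `f̂(S) = E[f(X)·χ_S(X)]` of a (vector-valued) function on the cube. -/
def cubeFourier {E : Type*} [AddCommGroup E] [Module ℝ E]
    (n : ℕ) (f : (Fin n → ℝ) → E) (S : Finset (Fin n)) : E :=
  (((2 : ℝ) ^ n)⁻¹) • ∑ x ∈ cube n, (∏ j ∈ S, x j) • f x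

/-- The Rademacher projection (linear part) `Rad f(x) = Σ_j f̂({j})·x_j`. -/
def rad {E : Type*} [AddCommGroup E] [Module ℝ E]
    (n : ℕ) (f : (Fin n → ℝ) → E) (x : Fin n → ℝ) : E :=
  ∑ j : Fin n, x j • cubeFourier n f {j}

/-- A sum over the cube of a product of one-coordinate functions factors. -/
theorem sum_cube_prod (n : ℕ) (f : Fin n → ℝ → ℝ) :
    ∑ x ∈ cube n, ∏ i, f i (x i) = ∏ i, (f i (-1) + f i 1) := by
  rw [cube, ← Finset.prod_univ_sum]
  refine Finset.prod_congr rfl fun i _ => ?_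
  rw [Finset.sum_pair (by norm_num)]

/-- The Riesz product `∏ (1 + ρ x_i)` has Fourier coefficients `ρ ^ |S|`. -/
theorem cubeFourier_prod_one_add (n : ℕ) (ρ : ℝ) (S : Finset (Fin n)) :
    cubeFourier n (fun x => ∏ i, (1 + ρ * x i)) S = ρ ^ S.card := by
  have h : ∀ x : Fin n → ℝ, (∏ j ∈ S, x j) • ∏ i, (1 + ρ * x i) =
      ∏ i, (if i ∈ S then x i else 1) * (1 + ρ * x i) := fun x => by
    rw [Finset.prod_mul_distrib, Finset.prod_ite_mem, Finset.univ_inter, smul_eq_mul]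
  simp only [cubeFourier, h]
  rw [sum_cube_prod n fun i t => (if i ∈ S then t else 1) * (1 + ρ * t)]
  have h2 : ∀ i, (if i ∈ S then (-1 : ℝ) else 1) * (1 + ρ * -1) +
      (if i ∈ S then (1 : ℝ) else 1) * (1 + ρ * 1) = 2 * if i ∈ S then ρ else 1 := fun i => by
    split_ifs <;> ring
  simp only [h2, Finset.prod_mul_distrib, Finset.prod_ite_mem, Finset.univ_inter,
    Finset.prod_const, Finset.card_univ, Fintype.card_fin, smul_eq_mul]
  field_simp

theorem cubeFourier_coord (n : ℕ) (j : Fin n) (S : Finset (Fin n)) :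
    cubeFourier n (fun x => x j) S = if S = {j} then 1 else 0 := by
  have h : ∀ x : Fin n → ℝ, (∏ j ∈ S, x j) • x j =
      ∏ i, (if i ∈ S then x i else 1) * (if i = j then x i else 1) := fun x => by
    rw [Finset.prod_mul_distrib, Finset.prod_ite_mem, Finset.univ_inter, smul_eq_mul]
    simp
  simp only [cubeFourier, h]
  rw [sum_cube_prod n fun i t => (if i ∈ S then t else 1) * (if i = j then t else 1)]
  have h2 : ∀ i, (if i ∈ S then (-1 : ℝ) else 1) * (if i = j then -1 else 1) +
      (if i ∈ S then (1 : ℝ) else 1) * (if i = j then 1 else 1) =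
      2 * if (i ∈ S ↔ i = j) then 1 else 0 := fun i => by
    split_ifs <;> first | tauto | norm_num
  simp only [h2, Finset.prod_mul_distrib, Finset.prod_const, Finset.card_univ, Fintype.card_fin,
    smul_eq_mul]
  rw [← mul_assoc, inv_mul_cancel₀ (by positivity), one_mul]
  split_ifs with hS
  · exact Finset.prod_eq_one fun i _ => by simp [hS]
  · obtain ⟨i, hi⟩ : ∃ i, ¬ (i ∈ S ↔ i = j) := by
      by_contra! hc
      exact hS (by ext i; simp [hc i])
    exact Finset.prod_eq_zero (Finset.mem_univ i) (by simp [hi])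

theorem cubeFourier_sum {ι : Type*} (n : ℕ) (s : Finset ι) (f : ι → (Fin n → ℝ) → ℝ)
    (S : Finset (Fin n)) :
    cubeFourier n (fun x => ∑ k ∈ s, f k x) S = ∑ k ∈ s, cubeFourier n (f k) S := by
  simp only [cubeFourier, Finset.smul_sum]
  rw [Finset.sum_comm]

theorem cubeFourier_const_mul (n : ℕ) (c : ℝ) (f : (Fin n → ℝ) → ℝ) (S : Finset (Fin n)) :
    cubeFourier n (fun x => c * f x) S = c * cubeFourier n f S := by
  simp only [cubeFourier, smul_eq_mul, Finset.mul_sum]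
  exact Finset.sum_congr rfl fun x _ => by ring

theorem cubeFourier_linear (n : ℕ) (S : Finset (Fin n)) :
    cubeFourier n (fun x => ∑ j : Fin n, x j) S = if S.card = 1 then 1 else 0 := by
  rw [cubeFourier_sum n univ fun j x => x j]
  simp only [cubeFourier_coord]
  split_ifs with h
  · obtain ⟨a, rfl⟩ := Finset.card_eq_one.1 h
    simp
  · refine Finset.sum_eq_zero fun j _ => if_neg ?_
    rintro rfl
    simp at h

/-- Riesz products with parameter in `[-1, 1]` are probability densities on the cube. -/
theorem cubeAvg_abs_sum_prod_le {ι : Type*} (n : ℕ) (s : Finset ι) (c ρ : ι → ℝ)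
    (hρ : ∀ k ∈ s, |ρ k| ≤ 1) :
    cubeAvg n (fun x => |∑ k ∈ s, c k * ∏ i, (1 + ρ k * x i)|) ≤ ∑ k ∈ s, |c k| := by
  have h : ∀ k, ∑ x ∈ cube n, ∏ i, (1 + ρ k * x i) = 2 ^ n := fun k => by
    rw [sum_cube_prod n fun _ t => 1 + ρ k * t, Finset.prod_congr rfl fun _ _ =>
      show (1 + ρ k * -1) + (1 + ρ k * 1) = 2 by ring]
    simp
  have hpos : ∀ x ∈ cube n, ∀ k ∈ s, 0 ≤ ∏ i, (1 + ρ k * x i) := fun x hx k hk => by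
    refine Finset.prod_nonneg fun i _ => ?_
    have hxi := Fintype.mem_piFinset.1 hx i
    have := abs_le.1 (hρ k hk)
    simp only [Finset.mem_insert, Finset.mem_singleton] at hxi
    rcases hxi with hxi | hxi <;> rw [hxi] <;> linarith
  rw [cubeAvg, div_le_iff₀ (by positivity)]
  calc ∑ x ∈ cube n, |∑ k ∈ s, c k * ∏ i, (1 + ρ k * x i)|
      ≤ ∑ x ∈ cube n, ∑ k ∈ s, |c k| * ∏ i, (1 + ρ k * x i) := by
        refine Finset.sum_le_sum fun x hx => (Finset.abs_sum_le_sum_abs _ _).trans ?_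
        refine Finset.sum_le_sum fun k hk => ?_
        rw [abs_mul, abs_of_nonneg (hpos x hx k hk)]
    _ = (∑ k ∈ s, |c k|) * 2 ^ n := by
        rw [Finset.sum_comm, Finset.sum_mul]
        exact Finset.sum_congr rfl fun k _ => by rw [← Finset.mul_sum, h]

/-- Orthogonality of characters of a cyclic group. -/
theorem sum_zpow_primitiveRoot {N : ℕ} {ζ : ℂ} (hζ : IsPrimitiveRoot ζ N) (t : ℤ)
    (ht : |t| < N) : ∑ j ∈ range N, (ζ ^ j) ^ t = if t = 0 then (N : ℂ) else 0 := by
  split_ifs with h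
  · simp [h]
  · have h1 : ζ ^ t ≠ 1 := fun hc => h <|
      Int.eq_zero_of_abs_lt_dvd ((hζ.zpow_eq_one_iff_dvd t).1 hc) ht
    have h2 : (ζ ^ t) ^ N = 1 := by
      rw [← zpow_natCast, ← zpow_mul, mul_comm, zpow_mul, zpow_natCast, hζ.pow_eq_one, one_zpow]
    have h3 : ∀ j ∈ range N, (ζ ^ j) ^ t = (ζ ^ t) ^ j := fun j _ => by
      rw [← zpow_natCast, ← zpow_natCast, ← zpow_mul, ← zpow_mul, mul_comm]
    rw [Finset.sum_congr rfl h3, geom_sum_eq h1, h2, sub_self, zero_div]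

theorem card_filter_sub_eq (ℓ : ℕ) (t : ℤ) :
    #{p ∈ range ℓ ×ˢ range ℓ | t + (p.1 : ℤ) - p.2 = 0} = (ℓ - |t|).toNat := by
  rcases le_total 0 t with h | h
  · rw [abs_of_nonneg h, ← Finset.card_range (ℓ - t).toNat]
    refine Finset.card_bij' (fun p _ => p.1) (fun a _ => (a, a + t.toNat)) ?_ ?_ ?_ ?_ <;>
      simp only [Finset.mem_filter, Finset.mem_product, Finset.mem_range, Prod.forall,
        Prod.mk.injEq] <;> grind
  · rw [abs_of_nonpos h, ← Finset.card_range (ℓ - -t).toNat]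
    refine Finset.card_bij' (fun p _ => p.2) (fun a _ => (a + (-t).toNat, a)) ?_ ?_ ?_ ?_ <;>
      simp only [Finset.mem_filter, Finset.mem_product, Finset.mem_range, Prod.forall,
        Prod.mk.injEq] <;> grind

/-- Fourier coefficients of the (discretised) Fejér kernel. -/
theorem sum_zpow_mul_normSq_geom {ℓ : ℕ} {ζ : ℂ} (hℓ : 0 < ℓ)
    (hζ : IsPrimitiveRoot ζ (4 * ℓ)) (t : ℤ) (ht : |t| ≤ 2 * ℓ) :
    ∑ j ∈ range (4 * ℓ), (ζ ^ j) ^ t * (Complex.normSq (∑ a ∈ range ℓ, (ζ ^ j) ^ a) : ℂ) =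
      4 * ℓ * ((ℓ - |t|).toNat : ℂ) := by
  have hnorm : ‖ζ‖ = 1 := hζ.norm'_eq_one (by omega)
  have hz : ∀ j : ℕ, ζ ^ j ≠ 0 := fun j => pow_ne_zero _ (by rintro rfl; simp at hnorm)
  have hconj : ∀ j : ℕ, (starRingEnd ℂ) (ζ ^ j) = (ζ ^ j)⁻¹ := fun j =>
    (Complex.inv_eq_conj (by simp [hnorm])).symm
  have h : ∀ j ∈ range (4 * ℓ),
      (ζ ^ j) ^ t * (Complex.normSq (∑ a ∈ range ℓ, (ζ ^ j) ^ a) : ℂ) =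
        ∑ p ∈ range ℓ ×ˢ range ℓ, (ζ ^ j) ^ (t + p.1 - p.2) := fun j _ => by
    rw [← Complex.mul_conj, map_sum, Finset.sum_mul_sum, ← Finset.sum_product', Finset.mul_sum]
    refine Finset.sum_congr rfl fun p _ => ?_
    rw [map_pow, hconj, zpow_sub₀ (hz j), zpow_add₀ (hz j), zpow_natCast, zpow_natCast, inv_pow]
    ring
  rw [Finset.sum_congr rfl h, Finset.sum_comm]
  have h' : ∀ p ∈ range ℓ ×ˢ range ℓ, ∑ j ∈ range (4 * ℓ), (ζ ^ j) ^ (t + p.1 - p.2) =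
      if t + (p.1 : ℤ) - p.2 = 0 then (4 * ℓ : ℂ) else 0 := fun p hp => by
    rw [Finset.mem_product, Finset.mem_range, Finset.mem_range] at hp
    rw [sum_zpow_primitiveRoot hζ]
    · push_cast; rfl
    · rw [abs_le] at ht
      rw [abs_lt]
      push_cast
      omega
  rw [Finset.sum_congr rfl h', ← Finset.sum_filter, Finset.sum_const, card_filter_sub_eq,
    nsmul_eq_mul, mul_comm]

/-- A signed measure on `[-1, 1]` of total mass at most `2ℓ` that represents differentiation
at the origin on polynomials of degree at most `ℓ`. -/
theorem exists_measure_deriv_zero (ℓ : ℕ) (hℓ : 0 < ℓ) :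
    ∃ w s : ℕ → ℝ, (∀ j, |s j| ≤ 1) ∧ ∑ j ∈ range (4 * ℓ), |w j| ≤ 2 * ℓ ∧
      ∀ m ≤ ℓ, ∑ j ∈ range (4 * ℓ), w j * s j ^ m = if m = 1 then 1 else 0 := by
  obtain ⟨ζ, hζ⟩ : ∃ ζ : ℂ, IsPrimitiveRoot ζ (4 * ℓ) :=
    ⟨_, Complex.isPrimitiveRoot_exp (4 * ℓ) (by omega)⟩
  have hℓ0 : (ℓ : ℂ) ≠ 0 := by exact_mod_cast hℓ.ne'
  have hnorm : ‖ζ‖ = 1 := hζ.norm'_eq_one (by omega)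
  have hz : ∀ j : ℕ, ζ ^ j ≠ 0 := fun j => pow_ne_zero _ (by rintro rfl; simp at hnorm)
  have him : ∀ j : ℕ, ((ζ ^ j).im : ℂ) = (ζ ^ j - (ζ ^ j)⁻¹) / (2 * Complex.I) := fun j => by
    rw [Complex.im_eq_sub_conj, Complex.inv_eq_conj (by simp [hnorm])]
  have himle : ∀ j : ℕ, |(ζ ^ j).im| ≤ 1 := fun j =>
    (Complex.abs_im_le_norm _).trans (by simp [hnorm])
  set F : ℕ → ℝ := fun j => Complex.normSq (∑ a ∈ range ℓ, (ζ ^ j) ^ a)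
  have hFejer := sum_zpow_mul_normSq_geom hℓ hζ
  set w : ℕ → ℝ := fun j => 2 / (4 * ℓ) * ((ζ ^ (j * ℓ)).im * F j)
  have hchar : ∀ k : ℤ, |k| ≤ ℓ →
      ∑ j ∈ range (4 * ℓ), (w j : ℂ) * (ζ ^ j) ^ k = Complex.I * k := fun k hk => by
    have h : ∀ j ∈ range (4 * ℓ), (w j : ℂ) * (ζ ^ j) ^ k =
        1 / (4 * ℓ * Complex.I) *
          ((ζ ^ j) ^ (k + ℓ) * (F j : ℂ) - (ζ ^ j) ^ (k - ℓ) * (F j : ℂ)) := fun j _ => by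
      have hI := Complex.I_ne_zero
      have := hz j
      simp only [w]
      push_cast
      rw [him, zpow_sub₀ (hz j), zpow_add₀ (hz j), zpow_natCast, pow_mul]
      field_simp
    rw [abs_le] at hk
    rw [Finset.sum_congr rfl h, ← Finset.mul_sum, Finset.sum_sub_distrib,
      hFejer (k + ℓ) (by rw [abs_le]; omega), hFejer (k - ℓ) (by rw [abs_le]; omega)]
    have hcount : (((ℓ - |k + ℓ|).toNat : ℤ) : ℂ) - (((ℓ - |k - ℓ|).toNat : ℤ) : ℂ) = -k := by
      rw [abs_of_nonneg (by omega : 0 ≤ k + ℓ), abs_of_nonpos (by omega : k - ℓ ≤ 0)]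
      have : (((ℓ - (k + ℓ)).toNat : ℤ)) - (((ℓ - -(k - ℓ)).toNat : ℤ)) = -k := by omega
      exact_mod_cast this
    simp only [Int.cast_natCast] at hcount
    rw [← mul_sub, hcount, one_div, mul_inv, Complex.inv_I]
    field_simp
  have hstep : ∀ (m : ℕ) (k : ℤ),
      ∑ j ∈ range (4 * ℓ), (w j : ℂ) * (ζ ^ j) ^ k * ((ζ ^ j).im : ℂ) ^ (m + 1) =
        1 / (2 * Complex.I) *
          (∑ j ∈ range (4 * ℓ), (w j : ℂ) * (ζ ^ j) ^ (k + 1) * ((ζ ^ j).im : ℂ) ^ m -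
          ∑ j ∈ range (4 * ℓ), (w j : ℂ) * (ζ ^ j) ^ (k - 1) * ((ζ ^ j).im : ℂ) ^ m) :=
    fun m k => by
      rw [← Finset.sum_sub_distrib, Finset.mul_sum]
      refine Finset.sum_congr rfl fun j _ => ?_
      rw [pow_succ, zpow_sub₀ (hz j), zpow_add₀ (hz j), zpow_one]
      nth_rewrite 2 [him]
      ring
  have hmom1 : ∀ k : ℤ, |k| ≤ ℓ - 1 →
      ∑ j ∈ range (4 * ℓ), (w j : ℂ) * (ζ ^ j) ^ k * ((ζ ^ j).im : ℂ) ^ 1 = 1 := fun k hk => by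
    rw [abs_le] at hk
    rw [hstep 0 k]
    simp only [pow_zero, mul_one]
    rw [hchar _ (by rw [abs_le]; omega), hchar _ (by rw [abs_le]; omega)]
    have hI := Complex.I_ne_zero
    push_cast
    field_simp
    ring
  have hmom2 : ∀ (m : ℕ) (k : ℤ), |k| ≤ ℓ - (m + 2) →
      ∑ j ∈ range (4 * ℓ), (w j : ℂ) * (ζ ^ j) ^ k * ((ζ ^ j).im : ℂ) ^ (m + 2) = 0 := by
    intro m
    induction m with
    | zero =>
      intro k hk
      rw [abs_le] at hk
      rw [hstep 1 k, hmom1 _ (by rw [abs_le]; omega), hmom1 _ (by rw [abs_le]; omega), sub_self, mul_zero]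
    | succ m ih =>
      intro k hk
      rw [abs_le] at hk
      rw [hstep (m + 2) k, ih _ (by rw [abs_le]; omega), ih _ (by rw [abs_le]; omega), sub_self, mul_zero]
  refine ⟨w, fun j => (ζ ^ j).im, himle, ?_, fun m hm => ?_⟩
  · have hmass : ∑ j ∈ range (4 * ℓ), F j = 4 * ℓ * ℓ := by
      have := hFejer 0 (by simp)
      simp only [zpow_zero, one_mul, abs_zero, sub_zero, Int.toNat_natCast] at this
      exact_mod_cast this
    have hℓR : (0 : ℝ) < ℓ := by exact_mod_cast hℓ
    calc ∑ j ∈ range (4 * ℓ), |w j| ≤ ∑ j ∈ range (4 * ℓ), 2 / (4 * ℓ) * F j := by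
          refine Finset.sum_le_sum fun j _ => ?_
          have hFj : 0 ≤ F j := Complex.normSq_nonneg _
          simp only [w]
          rw [abs_mul, abs_mul, abs_of_nonneg hFj, abs_of_nonneg (by positivity)]
          gcongr
          exact mul_le_of_le_one_left hFj (himle _)
      _ = 2 * ℓ := by
          rw [← Finset.mul_sum, hmass]
          field_simp
  · have key : ∑ j ∈ range (4 * ℓ), (w j : ℂ) * (ζ ^ j) ^ (0 : ℤ) * ((ζ ^ j).im : ℂ) ^ m =
        if m = 1 then 1 else 0 := by
      match m with
      | 0 => simpa using hchar 0 (by simp)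
      | 1 => simpa using hmom1 0 (by rw [abs_zero]; omega)
      | m + 2 => simpa using hmom2 m 0 (by rw [abs_zero]; omega)
    simp only [zpow_zero, mul_one] at key
    split_ifs at key ⊢ <;> exact_mod_cast key

/-- **Existence of the linear proxy.** For every odd `ℓ > 0` there is `P : {-1,1}^n → ℝ`
whose Fourier coefficients are within `8ℓ/2^ℓ` of those of `L(x) = Σ_j x_j`, and
whose `ℓ₁` norm is at most `8ℓ`. -/
theorem linear_proxy_exists (ℓ : ℕ) (hℓ : 0 < ℓ) (hodd : Odd ℓ) (n : ℕ) (hn : 1 ≤ n) :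
    ∃ P : (Fin n → ℝ) → ℝ,
      (∀ S : Finset (Fin n),
        |cubeFourier n P S - cubeFourier n (fun x => ∑ j : Fin n, x j) S| ≤
          8 * ℓ / 2 ^ ℓ) ∧
      cubeAvg n (fun x => |P x|) ≤ 8 * ℓ := by
  obtain ⟨w, s, hs, hw, hmom⟩ := exists_measure_deriv_zero ℓ hℓ
  have hcoeff : ∀ S : Finset (Fin n), cubeFourier n
      (fun x => ∑ k ∈ range (4 * ℓ), 2 * w k * ∏ i, (1 + s k / 2 * x i)) S =
        2 / 2 ^ S.card * ∑ k ∈ range (4 * ℓ), w k * s k ^ S.card := fun S => by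
    rw [cubeFourier_sum n (range (4 * ℓ)) fun k x => 2 * w k * ∏ i, (1 + s k / 2 * x i),
      Finset.mul_sum]
    refine Finset.sum_congr rfl fun k _ => ?_
    rw [cubeFourier_const_mul, cubeFourier_prod_one_add, div_pow]
    ring
  refine ⟨fun x => ∑ k ∈ range (4 * ℓ), 2 * w k * ∏ i, (1 + s k / 2 * x i), fun S => ?_, ?_⟩
  · rw [hcoeff, cubeFourier_linear]
    rcases le_or_gt S.card ℓ with h | h
    · rw [hmom _ h]
      split_ifs with h1
      · rw [h1]
        norm_num
        positivity
      · norm_num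
        positivity
    · rw [if_neg (by omega), sub_zero, abs_mul, abs_of_nonneg (by positivity)]
      have hsum : |∑ k ∈ range (4 * ℓ), w k * s k ^ S.card| ≤ 2 * ℓ := by
        refine (Finset.abs_sum_le_sum_abs _ _).trans (le_trans ?_ hw)
        refine Finset.sum_le_sum fun k _ => ?_
        rw [abs_mul, abs_pow]
        exact mul_le_of_le_one_right (abs_nonneg _) (pow_le_one₀ (abs_nonneg _) (hs k))
      calc 2 / 2 ^ S.card * |∑ k ∈ range (4 * ℓ), w k * s k ^ S.card|
          ≤ 2 / 2 ^ ℓ * (2 * ℓ) := by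
            gcongr
            norm_num
        _ = 4 * ℓ / 2 ^ ℓ := by ring
        _ ≤ 8 * ℓ / 2 ^ ℓ := by
            gcongr
            norm_num
  · refine (cubeAvg_abs_sum_prod_le n (range (4 * ℓ)) (fun k => 2 * w k) (fun k => s k / 2)
      fun k _ => ?_).trans ?_
    · have := abs_le.1 (hs k)
      rw [abs_le]
      constructor <;> linarith
    · simp only [abs_mul, abs_two, ← Finset.mul_sum]
      linarith [(Nat.cast_nonneg ℓ : (0 : ℝ) ≤ ℓ)]
end
end

section
/- Let ℓ > 0 be an odd integer, let Γ = {2πj/(4ℓ) : j = 0, 1, …, 4ℓ−1}, let θ be uniformly distributed on Γ \ {0, π}, and let φ(θ) = ((2ℓ−1)/ℓ)·sin(ℓθ)/sin²(θ). Define P : {-1,1}^n → ℝ by P(x) = 2·E_θ[φ(θ)·∏_{j=1}^n (1 + sin(θ)·x_j/2)]. Then: (i) P̂(S) = 1 whenever |S| = 1; (ii) P̂(S) = 0 whenever |S| ∈ {0, 2, 3, …, ℓ}; (iii) |P̂(S)| ≤ 8ℓ/2^ℓ whenever |S| > ℓ; and (iv) E[|P(X)|] ≤ 8ℓ, where X is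 uniform on {-1,1}^n. -/
open Finset Real

noncomputable section

/-- The function `φ(θ) = ((2ℓ−1)/ℓ)·sin(ℓθ)/sin²(θ)`. -/
def phiFn (ℓ : ℕ) (θ : ℝ) : ℝ :=
  ((2 * (ℓ : ℝ) - 1) / ℓ) * Real.sin (ℓ * θ) / (Real.sin θ) ^ 2

/-- The `4ℓ` equally spaced angles `2πj/(4ℓ)`, `j = 0, …, 4ℓ−1`. -/
def gammaSet (ℓ : ℕ) : Finset ℝ :=
  (Finset.range (4 * ℓ)).image fun j : ℕ => 2 * π * (j : ℝ) / (4 * ℓ)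

/-- The angles with the zeros `0, π` of `sin` removed. -/
def gammaSet' (ℓ : ℕ) : Finset ℝ :=
  gammaSet ℓ \ {0, π}

/-- The linear proxy `P(x) = 2·E_θ[φ(θ)·∏_j (1 + sin(θ)·x_j/2)]`,
with `θ` uniform on `Γ \ {0, π}`. -/
def linearProxy (ℓ n : ℕ) (x : Fin n → ℝ) : ℝ :=
  2 * ((∑ θ ∈ gammaSet' ℓ, phiFn ℓ θ * ∏ j : Fin n, (1 + Real.sin θ * x j / 2)) /
        ((gammaSet' ℓ).card : ℝ))

/-- Independence of the coordinates: the Fourier coefficients of a product of affine factors. -/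
lemma sum_cube_prod_mul_prod_one_add (n : ℕ) (S : Finset (Fin n)) (c : ℝ) :
    ∑ x ∈ cube n, (∏ j ∈ S, x j) * ∏ j : Fin n, (1 + c * x j) = 2 ^ n * c ^ S.card := by
  have hfactor : ∀ x : Fin n → ℝ, (∏ j ∈ S, x j) * ∏ j : Fin n, (1 + c * x j) =
      ∏ j : Fin n, (if j ∈ S then x j else 1) * (1 + c * x j) := by
    intro x
    rw [Finset.prod_mul_distrib, Finset.prod_ite_mem, Finset.univ_inter]
  simp_rw [hfactor]
  rw [cube, ← Finset.prod_univ_sum (fun _ => ({-1, 1} : Finset ℝ))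
    (fun (j : Fin n) (t : ℝ) => (if j ∈ S then t else 1) * (1 + c * t))]
  have hsum : ∀ j : Fin n, ∑ t ∈ ({-1, 1} : Finset ℝ), (if j ∈ S then t else 1) * (1 + c * t) =
      2 * if j ∈ S then c else 1 := by
    intro j
    rw [Finset.sum_pair (by norm_num)]
    split_ifs <;> ring
  simp_rw [hsum]
  rw [Finset.prod_mul_distrib, Finset.prod_ite_mem, Finset.univ_inter]
  simp

lemma injective_gamma_angle {ℓ : ℕ} (hℓ : 0 < ℓ) :
    Function.Injective fun j : ℕ => 2 * π * (j : ℝ) / (4 * ℓ) := by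
  intro a b h
  have hℓ' : (ℓ : ℝ) ≠ 0 := by positivity
  have hπ := Real.pi_ne_zero
  simp only at h
  field_simp at h
  exact_mod_cast h

lemma sum_gammaSet' {ℓ : ℕ} (hℓ : 0 < ℓ) (f : ℝ → ℝ) :
    ∑ θ ∈ gammaSet' ℓ, f θ =
      ∑ j ∈ Finset.range (4 * ℓ), f (2 * π * (j : ℝ) / (4 * ℓ)) - (f 0 + f π) := by
  have hℓ' : (ℓ : ℝ) ≠ 0 := by positivity
  have hsub : ({0, π} : Finset ℝ) ⊆ gammaSet ℓ := by
    intro x hx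
    simp only [Finset.mem_insert, Finset.mem_singleton] at hx
    rw [gammaSet, Finset.mem_image]
    rcases hx with rfl | rfl
    · exact ⟨0, by simpa using hℓ, by simp⟩
    · refine ⟨2 * ℓ, by simp; omega, ?_⟩
      push_cast
      field_simp
      ring
  rw [gammaSet', eq_sub_iff_add_eq, ← Finset.sum_pair (f := f) Real.pi_ne_zero.symm,
    Finset.sum_sdiff hsub, gammaSet, Finset.sum_image (injective_gamma_angle hℓ).injOn]

lemma card_gammaSet' {ℓ : ℕ} (hℓ : 0 < ℓ) : ((gammaSet' ℓ).card : ℝ) = 4 * ℓ - 2 := by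
  have h := sum_gammaSet' hℓ (fun _ => 1)
  simp only [Finset.sum_const, nsmul_eq_mul, mul_one, Finset.card_range] at h
  rw [h]
  push_cast
  ring

lemma sin_ne_zero_of_mem_gammaSet' {ℓ : ℕ} (hℓ : 0 < ℓ) {θ : ℝ} (hθ : θ ∈ gammaSet' ℓ) :
    Real.sin θ ≠ 0 := by
  simp only [gammaSet', gammaSet, Finset.mem_sdiff, Finset.mem_image, Finset.mem_range,
    Finset.mem_insert, Finset.mem_singleton, not_or] at hθ
  obtain ⟨⟨j, hj, rfl⟩, h0, hp⟩ := hθ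
  have hℓ' : (0 : ℝ) < ℓ := by positivity
  intro hs
  obtain ⟨m, hm⟩ := Real.sin_eq_zero_iff.mp hs
  have hπ := Real.pi_pos
  have hmj : (m : ℝ) * (2 * ℓ) = j := by
    field_simp at hm
    linarith
  have hmj' : m * (2 * ℓ) = j := by exact_mod_cast hmj
  have hm0 : 0 ≤ m := by
    by_contra! hneg
    nlinarith
  have hm2 : m < 2 := by
    by_contra! hge
    have : (j : ℤ) < 4 * ℓ := by exact_mod_cast hj
    nlinarith
  interval_cases m
  · exact h0 (by rw [← hm]; simp)
  · exact hp (by rw [← hm]; simp)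

lemma sum_range_exp_eq_zero {N a : ℕ} (ha : 0 < a) (haN : a < N) :
    ∑ j ∈ Finset.range N, Complex.exp (((a * (2 * π * j / N) : ℝ) : ℂ) * Complex.I) = 0 := by
  have hN : N ≠ 0 := by omega
  have hprim := Complex.isPrimitiveRoot_exp N hN
  set ζ : ℂ := Complex.exp (2 * π * Complex.I / N)
  have hne : ζ ^ a ≠ 1 := hprim.pow_ne_one_of_pos_of_lt ha.ne' haN
  have hterm : ∀ j : ℕ,
      Complex.exp (((a * (2 * π * j / N) : ℝ) : ℂ) * Complex.I) = (ζ ^ a) ^ j := by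
    intro j
    rw [← pow_mul, ← Complex.exp_nat_mul]
    congr 1
    push_cast
    ring
  simp_rw [hterm]
  rw [geom_sum_eq hne, ← pow_mul, mul_comm a N, pow_mul, hprim.pow_eq_one]
  simp

lemma sum_range_cos_eq_zero {N a : ℕ} (ha : 0 < a) (haN : a < N) :
    ∑ j ∈ Finset.range N, Real.cos (a * (2 * π * j / N)) = 0 := by
  have h := congrArg Complex.re (sum_range_exp_eq_zero ha haN)
  simpa only [Complex.re_sum, Complex.exp_ofReal_mul_I_re, Complex.zero_re] using h

lemma sum_range_sin_eq_zero {N a : ℕ} (ha : 0 < a) (haN : a < N) :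
    ∑ j ∈ Finset.range N, Real.sin (a * (2 * π * j / N)) = 0 := by
  have h := congrArg Complex.im (sum_range_exp_eq_zero ha haN)
  simpa only [Complex.im_sum, Complex.exp_ofReal_mul_I_im, Complex.zero_im] using h

/-- High frequencies are orthogonal to low powers of the sine on equally spaced points. -/
lemma sum_range_mul_sin_pow_eq_zero (N m : ℕ) : ∀ a : ℕ, m < a → a + m < N →
    ∑ j ∈ Finset.range N, Real.cos (a * (2 * π * j / N)) * Real.sin (2 * π * j / N) ^ m = 0 ∧
    ∑ j ∈ Finset.range N, Real.sin (a * (2 * π * j / N)) * Real.sin (2 * π * j / N) ^ m = 0 := by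
  induction m with
  | zero =>
    intro a ha haN
    simpa using ⟨sum_range_cos_eq_zero ha haN, sum_range_sin_eq_zero ha haN⟩
  | succ m ih =>
    intro a ha haN
    obtain ⟨b, rfl⟩ : ∃ b, a = b + 1 := ⟨a - 1, by omega⟩
    obtain ⟨c₁, s₁⟩ := ih b (by omega) (by omega)
    obtain ⟨c₂, s₂⟩ := ih (b + 2) (by omega) (by omega)
    have hcos : ∀ θ : ℝ, Real.cos ((b + 1 : ℕ) * θ) * Real.sin θ ^ (m + 1) =
        (Real.sin ((b + 2 : ℕ) * θ) * Real.sin θ ^ m - Real.sin (b * θ) * Real.sin θ ^ m) / 2 := by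
      intro θ
      have e₁ : ((b + 2 : ℕ) : ℝ) * θ = (b + 1 : ℕ) * θ + θ := by push_cast; ring
      have e₂ : (b : ℝ) * θ = (b + 1 : ℕ) * θ - θ := by push_cast; ring
      rw [e₁, e₂, Real.sin_add, Real.sin_sub]
      ring
    have hsin : ∀ θ : ℝ, Real.sin ((b + 1 : ℕ) * θ) * Real.sin θ ^ (m + 1) =
        (Real.cos (b * θ) * Real.sin θ ^ m - Real.cos ((b + 2 : ℕ) * θ) * Real.sin θ ^ m) / 2 := by
      intro θ
      have e₁ : ((b + 2 : ℕ) : ℝ) * θ = (b + 1 : ℕ) * θ + θ := by push_cast; ring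
      have e₂ : (b : ℝ) * θ = (b + 1 : ℕ) * θ - θ := by push_cast; ring
      rw [e₁, e₂, Real.cos_add, Real.cos_sub]
      ring
    simp_rw [hcos, hsin, ← Finset.sum_div, Finset.sum_sub_distrib]
    rw [c₁, c₂, s₁, s₂]
    simp

/-- The sum of a Dirichlet kernel over the angles of `gammaSet'`. -/
lemma sum_gammaSet'_sin_odd_mul_div_sin {ℓ : ℕ} (hℓ : 0 < ℓ) (k : ℕ) (hk : k < 2 * ℓ) :
    ∑ θ ∈ gammaSet' ℓ, Real.sin ((2 * k + 1 : ℕ) * θ) / Real.sin θ =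
      4 * ℓ - 2 * (2 * k + 1) := by
  induction k with
  | zero =>
    rw [Finset.sum_congr rfl (g := fun _ => (1 : ℝ))]
    · simp [card_gammaSet' hℓ]
    · intro θ hθ
      simp [sin_ne_zero_of_mem_gammaSet' hℓ hθ]
  | succ k ih =>
    have hstep : ∀ θ ∈ gammaSet' ℓ,
        Real.sin ((2 * (k + 1) + 1 : ℕ) * θ) / Real.sin θ =
          Real.sin ((2 * k + 1 : ℕ) * θ) / Real.sin θ + 2 * Real.cos ((2 * k + 2 : ℕ) * θ) := by
      intro θ hθ
      have hs := sin_ne_zero_of_mem_gammaSet' hℓ hθ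
      have e₁ : ((2 * (k + 1) + 1 : ℕ) : ℝ) * θ = (2 * k + 2 : ℕ) * θ + θ := by push_cast; ring
      have e₂ : ((2 * k + 1 : ℕ) : ℝ) * θ = (2 * k + 2 : ℕ) * θ - θ := by push_cast; ring
      rw [e₁, e₂, Real.sin_add, Real.sin_sub]
      field_simp
      ring
    have hcos := sum_range_cos_eq_zero (N := 4 * ℓ) (a := 2 * k + 2) (by omega) (by omega)
    have hpi : Real.cos ((2 * k + 2 : ℕ) * π) = 1 := by
      rw [← Real.cos_nat_mul_two_pi (k + 1)]
      congr 1
      push_cast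
      ring
    rw [Finset.sum_congr rfl hstep, Finset.sum_add_distrib, ih (by omega), ← Finset.mul_sum,
      sum_gammaSet' hℓ (fun θ => Real.cos ((2 * k + 2 : ℕ) * θ)), hpi]
    push_cast at hcos ⊢
    rw [hcos]
    simp
    ring

lemma sum_gammaSet'_sin_sq_div_sin_sq {ℓ : ℕ} (hℓ : 0 < ℓ) (k : ℕ) (hk : k ≤ 2 * ℓ) :
    ∑ θ ∈ gammaSet' ℓ, Real.sin (k * θ) ^ 2 / Real.sin θ ^ 2 = 4 * ℓ * k - 2 * k ^ 2 := by
  induction k with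
  | zero => simp
  | succ k ih =>
    have hstep : ∀ θ ∈ gammaSet' ℓ, Real.sin ((k + 1 : ℕ) * θ) ^ 2 / Real.sin θ ^ 2 =
        Real.sin (k * θ) ^ 2 / Real.sin θ ^ 2 + Real.sin ((2 * k + 1 : ℕ) * θ) / Real.sin θ := by
      intro θ hθ
      have hs := sin_ne_zero_of_mem_gammaSet' hℓ hθ
      have e₁ : ((k + 1 : ℕ) : ℝ) * θ = k * θ + θ := by push_cast; ring
      have e₂ : ((2 * k + 1 : ℕ) : ℝ) * θ = k * θ + (k * θ + θ) := by push_cast; ring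
      rw [e₁, e₂, Real.sin_add (k * θ) (k * θ + θ), Real.sin_add (k * θ), Real.cos_add (k * θ)]
      field_simp
      linear_combination (Real.sin (k * θ) ^ 2) * Real.sin_sq_add_cos_sq θ
    rw [Finset.sum_congr rfl hstep, Finset.sum_add_distrib, ih (by omega),
      sum_gammaSet'_sin_odd_mul_div_sin hℓ k (by omega)]
    push_cast
    ring

lemma abs_sin_mul_eq_sq_of_mem_gammaSet' {ℓ : ℕ} (hℓ : 0 < ℓ) {θ : ℝ} (hθ : θ ∈ gammaSet' ℓ) :
    |Real.sin (ℓ * θ)| = Real.sin (ℓ * θ) ^ 2 := by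
  simp only [gammaSet', gammaSet, Finset.mem_sdiff, Finset.mem_image] at hθ
  obtain ⟨⟨j, -, rfl⟩, -⟩ := hθ
  have hℓ' : (ℓ : ℝ) ≠ 0 := by positivity
  have hang : (ℓ : ℝ) * (2 * π * j / (4 * ℓ)) = j * π / 2 := by
    field_simp
    ring
  rw [hang, ← sq_abs]
  have hprod : Real.sin (j * π / 2) * Real.cos (j * π / 2) = 0 := by
    have h := Real.sin_two_mul (j * π / 2)
    rw [mul_div_cancel₀ _ two_ne_zero, Real.sin_nat_mul_pi] at h
    linarith
  have hone := Real.sin_sq_add_cos_sq (j * π / 2)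
  rcases mul_eq_zero.mp hprod with h | h
  · simp [h]
  · have : |Real.sin (j * π / 2)| = 1 := by
      rw [← pow_eq_one_iff_of_nonneg (abs_nonneg _) two_ne_zero, sq_abs]
      simpa [h] using hone
    simp [this]

lemma linearProxy_eq_sum {ℓ : ℕ} (hℓ : 0 < ℓ) (n : ℕ) (x : Fin n → ℝ) :
    linearProxy ℓ n x = (ℓ : ℝ)⁻¹ * ∑ θ ∈ gammaSet' ℓ,
      Real.sin (ℓ * θ) / Real.sin θ ^ 2 * ∏ j : Fin n, (1 + Real.sin θ / 2 * x j) := by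
  have hℓ' : (1 : ℝ) ≤ ℓ := by exact_mod_cast hℓ
  have hc : (4 * (ℓ : ℝ) - 2) ≠ 0 := by linarith
  rw [linearProxy, card_gammaSet' hℓ, Finset.sum_div, Finset.mul_sum, Finset.mul_sum]
  refine Finset.sum_congr rfl fun θ _ => ?_
  have hprod : ∏ j : Fin n, (1 + Real.sin θ * x j / 2) =
      ∏ j : Fin n, (1 + Real.sin θ / 2 * x j) :=
    Finset.prod_congr rfl fun j _ => by ring
  rw [hprod, phiFn]
  have hscale : 2 * ((2 * (ℓ : ℝ) - 1) / ℓ) / (4 * ℓ - 2) = (ℓ : ℝ)⁻¹ := by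
    rw [div_eq_iff hc]
    field_simp
    ring
  rw [← hscale]
  ring

lemma cubeFourier_linearProxy {ℓ : ℕ} (hℓ : 0 < ℓ) (n : ℕ) (S : Finset (Fin n)) :
    cubeFourier n (linearProxy ℓ n) S = (ℓ : ℝ)⁻¹ * ∑ θ ∈ gammaSet' ℓ,
      Real.sin (ℓ * θ) / Real.sin θ ^ 2 * (Real.sin θ / 2) ^ S.card := by
  simp only [cubeFourier, smul_eq_mul, linearProxy_eq_sum hℓ, Finset.mul_sum]
  rw [Finset.sum_comm]
  refine Finset.sum_congr rfl fun θ _ => ?_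
  have h := sum_cube_prod_mul_prod_one_add n S (Real.sin θ / 2)
  calc _ = ((2 : ℝ) ^ n)⁻¹ * ((ℓ : ℝ)⁻¹ * (Real.sin (ℓ * θ) / Real.sin θ ^ 2)) *
        ∑ x ∈ cube n, (∏ j ∈ S, x j) * ∏ j : Fin n, (1 + Real.sin θ / 2 * x j) := by
        rw [Finset.mul_sum]
        exact Finset.sum_congr rfl fun x _ => by ring
    _ = _ := by
        rw [h]
        field_simp

lemma cubeFourier_linearProxy_of_two_le {ℓ : ℕ} (hℓ : 0 < ℓ) (n : ℕ) (S : Finset (Fin n))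
    (hS : 2 ≤ S.card) :
    cubeFourier n (linearProxy ℓ n) S = (ℓ : ℝ)⁻¹ * ((2 ^ S.card)⁻¹ * ∑ θ ∈ gammaSet' ℓ,
      Real.sin (ℓ * θ) * Real.sin θ ^ (S.card - 2)) := by
  rw [cubeFourier_linearProxy hℓ, Finset.mul_sum (a := ((2 : ℝ) ^ S.card)⁻¹)]
  congr 1
  refine Finset.sum_congr rfl fun θ hθ => ?_
  have hs := sin_ne_zero_of_mem_gammaSet' hℓ hθ
  obtain ⟨m, hm⟩ := Nat.exists_eq_add_of_le hS
  rw [hm, Nat.add_sub_cancel_left, div_pow, pow_add (Real.sin θ)]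
  field_simp

lemma sum_gammaSet'_sin_div_sin_sq {ℓ : ℕ} (hodd : Odd ℓ) :
    ∑ θ ∈ gammaSet' ℓ, Real.sin (ℓ * θ) / Real.sin θ ^ 2 = 0 := by
  have hℓ' : (ℓ : ℝ) ≠ 0 := by exact_mod_cast hodd.pos.ne'
  have hanti : ∀ j : ℕ,
      Real.sin (ℓ * (2 * π * (2 * ℓ + j : ℕ) / (4 * ℓ))) /
        Real.sin (2 * π * (2 * ℓ + j : ℕ) / (4 * ℓ)) ^ 2 =
      -(Real.sin (ℓ * (2 * π * j / (4 * ℓ))) / Real.sin (2 * π * j / (4 * ℓ)) ^ 2) := by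
    intro j
    have e : 2 * π * (2 * ℓ + j : ℕ) / (4 * ℓ) = 2 * π * j / (4 * ℓ) + π := by
      push_cast
      field_simp
      ring
    rw [e, mul_add, Real.sin_add_pi, Real.sin_add_nat_mul_pi, hodd.neg_one_pow, neg_sq]
    ring
  rw [sum_gammaSet' hodd.pos, show 4 * ℓ = 2 * ℓ + 2 * ℓ by ring, Finset.sum_range_add]
  simp only [hanti]
  simp

lemma cubeAvg_abs_linearProxy_le {ℓ : ℕ} (hℓ : 0 < ℓ) (n : ℕ) :
    cubeAvg n (fun x => |linearProxy ℓ n x|) ≤ 2 * ℓ := by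
  have hℓ' : (0 : ℝ) < ℓ := by exact_mod_cast hℓ
  have hpoint : ∀ x ∈ cube n, |linearProxy ℓ n x| ≤ (ℓ : ℝ)⁻¹ * ∑ θ ∈ gammaSet' ℓ,
      Real.sin (ℓ * θ) ^ 2 / Real.sin θ ^ 2 * ∏ j : Fin n, (1 + Real.sin θ / 2 * x j) := by
    intro x hx
    rw [linearProxy_eq_sum hℓ, abs_mul, abs_of_pos (inv_pos.mpr hℓ')]
    gcongr
    refine (Finset.abs_sum_le_sum_abs _ _).trans_eq (Finset.sum_congr rfl fun θ hθ => ?_)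
    have hnonneg : 0 ≤ ∏ j : Fin n, (1 + Real.sin θ / 2 * x j) := by
      refine Finset.prod_nonneg fun j _ => ?_
      have hxj := Fintype.mem_piFinset.mp hx j
      simp only [Finset.mem_insert, Finset.mem_singleton] at hxj
      have h₁ := Real.sin_le_one θ
      have h₂ := Real.neg_one_le_sin θ
      rcases hxj with h | h <;> rw [h] <;> linarith
    rw [abs_mul, abs_div, abs_of_nonneg hnonneg, abs_of_nonneg (sq_nonneg (Real.sin θ)),
      abs_sin_mul_eq_sq_of_mem_gammaSet' hℓ hθ]
  rw [cubeAvg, div_le_iff₀ (by positivity)]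
  refine (Finset.sum_le_sum hpoint).trans_eq ?_
  rw [← Finset.mul_sum, Finset.sum_comm]
  have hmean : ∀ θ : ℝ, ∑ x ∈ cube n, ∏ j : Fin n, (1 + Real.sin θ / 2 * x j) = 2 ^ n := by
    intro θ
    simpa using sum_cube_prod_mul_prod_one_add n ∅ (Real.sin θ / 2)
  simp_rw [← Finset.mul_sum, hmean]
  rw [← Finset.sum_mul, sum_gammaSet'_sin_sq_div_sin_sq hℓ ℓ (by omega)]
  field_simp
  ring

/-- **Properties of the linear proxy.** -/
theorem linear_proxy_properties (ℓ : ℕ) (hℓ : 0 < ℓ) (hodd : Odd ℓ) (n : ℕ) (hn : 1 ≤ n) :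
    (∀ S : Finset (Fin n), S.card = 1 → cubeFourier n (linearProxy ℓ n) S = 1) ∧
    (∀ S : Finset (Fin n), S.card = 0 ∨ (2 ≤ S.card ∧ S.card ≤ ℓ) →
      cubeFourier n (linearProxy ℓ n) S = 0) ∧
    (∀ S : Finset (Fin n), ℓ < S.card →
      |cubeFourier n (linearProxy ℓ n) S| ≤ 8 * ℓ / 2 ^ ℓ) ∧
    cubeAvg n (fun x => |linearProxy ℓ n x|) ≤ 8 * ℓ := by
  have hℓ₁ : (1 : ℝ) ≤ ℓ := by exact_mod_cast hℓ
  refine ⟨fun S hS => ?_, fun S hS => ?_, fun S hS => ?_, ?_⟩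
  · obtain ⟨k, hk⟩ := hodd
    have hsum := sum_gammaSet'_sin_odd_mul_div_sin hℓ k (by omega)
    rw [← hk] at hsum
    have hterm : ∀ θ ∈ gammaSet' ℓ, Real.sin (ℓ * θ) / Real.sin θ ^ 2 * (Real.sin θ / 2) ^ 1 =
        Real.sin (ℓ * θ) / Real.sin θ / 2 := by
      intro θ hθ
      have hs := sin_ne_zero_of_mem_gammaSet' hℓ hθ
      field_simp
    have hcast : (ℓ : ℝ) = 2 * k + 1 := by exact_mod_cast hk
    rw [cubeFourier_linearProxy hℓ, hS, Finset.sum_congr rfl hterm, ← Finset.sum_div, hsum,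
      ← hcast]
    field_simp
    ring
  · rcases hS with hS | ⟨h₂, hle⟩
    · simp [cubeFourier_linearProxy hℓ, hS, sum_gammaSet'_sin_div_sin_sq hodd]
    · have hzero :=
        (sum_range_mul_sin_pow_eq_zero (4 * ℓ) (S.card - 2) ℓ (by omega) (by omega)).2
      push_cast at hzero
      rw [cubeFourier_linearProxy_of_two_le hℓ n S h₂, sum_gammaSet' hℓ, hzero]
      simp
  · have hsum : |∑ θ ∈ gammaSet' ℓ, Real.sin (ℓ * θ) * Real.sin θ ^ (S.card - 2)| ≤ 4 * ℓ := by
      calc _ ≤ ∑ θ ∈ gammaSet' ℓ, |Real.sin (ℓ * θ) * Real.sin θ ^ (S.card - 2)| :=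
            Finset.abs_sum_le_sum_abs _ _
        _ ≤ ∑ θ ∈ gammaSet' ℓ, 1 := by
            refine Finset.sum_le_sum fun θ _ => ?_
            rw [abs_mul, abs_pow]
            exact mul_le_one₀ (Real.abs_sin_le_one _) (by positivity)
              (pow_le_one₀ (abs_nonneg _) (Real.abs_sin_le_one _))
        _ ≤ 4 * ℓ := by
            rw [Finset.sum_const, nsmul_eq_mul, mul_one, card_gammaSet' hℓ]
            linarith
    rw [cubeFourier_linearProxy_of_two_le hℓ n S (by omega), abs_mul, abs_mul,
      abs_of_pos (by positivity : (0 : ℝ) < (ℓ : ℝ)⁻¹),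
      abs_of_pos (by positivity : (0 : ℝ) < (2 ^ S.card)⁻¹)]
    calc _ ≤ (ℓ : ℝ)⁻¹ * ((2 ^ ℓ)⁻¹ * (4 * ℓ)) := by
          gcongr
          norm_num
      _ = 4 / 2 ^ ℓ := by field_simp
      _ ≤ 8 * ℓ / 2 ^ ℓ := by
          gcongr
          linarith
  · exact (cubeAvg_abs_linearProxy_le hℓ n).trans (by linarith)
end
end
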